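/- arXiv:1606.04224 — 2 statements merged into one kernel-verified Lean document; each statement's English description precedes it below -/
import Mathlib

section
/- Let q ≥ 2 and d ≥ 2, and let X_1, …, X_q ⊆ ℝ^d be nonempty closed sets, each having positive reach (say X_i has reach at least r_i > 0). Let NK := (nor X_1 × ⋯ × nor X_q) ∩ R^c and define the map T : NK × S^{q-1}_+ → ℝ^{qd} × S^{d-1} by T(x_1,u_1,…,x_q,u_q,t) := (x_1,…,x_q, (∑_{i=1}^q t_i u_i)/‖∑_{i=1}^q t_i u_i‖). Then for H^{qd-1}-almost all points y of the image of T the preimage T^{-1}({y}) is a single point; that is, the set of points y ∈ im(T) whose preimage under T contains more than one element has (qd−1)-dimensional Hausdorff measure zero (Hausdorff measure taken in the ambient space ℝ^{(q+1)d} ≅ ℝ^{qd} × ℝ^d). -/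
open MeasureTheory Metric Set

noncomputable section

/-- A nonempty closed set `X ⊆ ℝ^d` has reach at least `r > 0` if every point `z` with
`dist(z, X) < r` has a unique nearest point in `X`. -/
def HasReachGE {d : ℕ} (X : Set (EuclideanSpace ℝ (Fin d))) (r : ℝ) : Prop :=
  ∀ z : EuclideanSpace ℝ (Fin d), Metric.infDist z X < r →
    ∃! x, x ∈ X ∧ dist z x = Metric.infDist z X

/-- The unit normal bundle of a set `X` of reach at least `r`:
pairs `(x, u)` with `x ∈ X`, `‖u‖ = 1` and `dist(x + t u, X) = t` for all `t ∈ (0, r)`. -/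
def unitNormalBundle {d : ℕ} (X : Set (EuclideanSpace ℝ (Fin d))) (r : ℝ) :
    Set (EuclideanSpace ℝ (Fin d) × EuclideanSpace ℝ (Fin d)) :=
  {p | p.1 ∈ X ∧ ‖p.2‖ = 1 ∧
    ∀ t ∈ Set.Ioo (0 : ℝ) r, Metric.infDist (p.1 + t • p.2) X = t}

/-- `cone{u_1, …, u_q}`: all nonnegative combinations of `u_1, …, u_q` with not all
coefficients zero. -/
def coneOf {d q : ℕ} (u : Fin q → EuclideanSpace ℝ (Fin d)) :
    Set (EuclideanSpace ℝ (Fin d)) :=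
  {v | ∃ lam : Fin q → ℝ, (∀ i, 0 ≤ lam i) ∧ 0 < ∑ i, (lam i) ^ 2 ∧ v = ∑ i, lam i • u i}

open Filter Topology ENNReal in
/-- A set of Hausdorff measure zero has covers by small sets with small total size. -/
theorem exists_cover_of_hausdorffMeasure_eq_zero {Y : Type*} [EMetricSpace Y] [MeasurableSpace Y]
    [BorelSpace Y] {b : ℝ} (hb : 0 < b) {s : Set Y} (hs : μH[b] s = 0) {r ε : ℝ≥0∞}
    (hr : 0 < r) (hε : 0 < ε) :
    ∃ t : ℕ → Set Y, s ⊆ ⋃ n, t n ∧ (∀ n, ediam (t n) ≤ r) ∧ ∑' n, ediam (t n) ^ b < ε := by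
  rw [Measure.hausdorffMeasure_apply] at hs
  simp only [ENNReal.iSup_eq_zero] at hs
  have h := (hs r hr).trans_lt hε
  simp only [iInf_lt_iff] at h
  obtain ⟨t, hst, htr, ht⟩ := h
  refine ⟨t, hst, htr, lt_of_le_of_lt (ENNReal.tsum_le_tsum fun n => ?_) ht⟩
  rcases (t n).eq_empty_or_nonempty with h | h
  · simp [h, ENNReal.zero_rpow_of_pos hb]
  · simp [h]

open Filter Topology ENNReal in
/-- Almost every slice, along a 1-Lipschitz real function, of an `H^{a+1}`-null set is
`H^a`-null. -/
theorem ae_hausdorffMeasure_slice_eq_zero {Y : Type*} [EMetricSpace Y] [MeasurableSpace Y]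
    [BorelSpace Y] {a : ℝ} (ha : 0 < a) {s : Set Y} (hs : μH[a + 1] s = 0) {f : Y → ℝ}
    (hf : LipschitzWith 1 f) : ∀ᵐ t : ℝ, μH[a] (s ∩ f ⁻¹' {t}) = 0 := by
  obtain ⟨ε, hε, hεs⟩ := ENNReal.exists_pos_sum_of_countable (ε := 1) one_ne_zero ℕ
  have hr : ∀ k : ℕ, 0 < ((k : ℝ≥0∞)⁻¹) := fun k => by simp
  choose U hsU hUr hUε using fun k : ℕ =>
    exists_cover_of_hausdorffMeasure_eq_zero (by positivity : 0 < a + 1) hs (hr k)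
      (ENNReal.coe_pos.2 (hε k))
  let g : ℕ → ℝ → ℝ≥0∞ := fun k t =>
    ∑' i, (closure (f '' U k i)).indicator (fun _ => ediam (U k i) ^ a) t
  have hgm : ∀ k, Measurable (g k) := fun k =>
    Measurable.tsum fun i => measurable_const.indicator isClosed_closure.measurableSet
  have hg : ∀ k, ∫⁻ t, g k t ≤ ε k := fun k => by
    rw [lintegral_tsum fun i =>
      (measurable_const.indicator isClosed_closure.measurableSet).aemeasurable]
    refine (ENNReal.tsum_le_tsum fun i => ?_).trans (hUε k).le
    rw [lintegral_indicator_const isClosed_closure.measurableSet,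
      ENNReal.rpow_add_of_nonneg _ _ ha.le zero_le_one, ENNReal.rpow_one]
    gcongr
    refine (Real.volume_le_diam _).trans ?_
    rw [ediam_closure]
    simpa using hf.ediam_image_le (U k i)
  have hint : ∫⁻ t, ∑' k, g k t ≠ ∞ := by
    rw [lintegral_tsum fun k => (hgm k).aemeasurable]
    exact (((ENNReal.tsum_le_tsum hg).trans_lt hεs).trans one_lt_top).ne
  filter_upwards [ae_lt_top (Measurable.tsum hgm) hint] with t ht
  have h0 : Tendsto (fun k => g k t) atTop (𝓝 0) :=
    ENNReal.tendsto_atTop_zero_of_tsum_ne_top ht.ne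
  refine le_antisymm ?_ zero_le
  refine (Measure.hausdorffMeasure_le_liminf_tsum a (s ∩ f ⁻¹' {t}) (l := atTop)
    (fun k : ℕ => (k : ℝ≥0∞)⁻¹) ENNReal.tendsto_inv_nat_nhds_zero
    (fun k i => U k i ∩ f ⁻¹' {t}) ?_ ?_).trans ?_
  · exact Eventually.of_forall fun k i => (ediam_mono inter_subset_left).trans (hUr k i)
  · refine Eventually.of_forall fun k y hy => ?_
    obtain ⟨i, hi⟩ := mem_iUnion.1 (hsU k hy.1)
    exact mem_iUnion.2 ⟨i, hi, hy.2⟩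
  · rw [← h0.liminf_eq]
    refine liminf_le_liminf (Eventually.of_forall fun k => ENNReal.tsum_le_tsum fun i => ?_)
    rcases (U k i ∩ f ⁻¹' {t}).eq_empty_or_nonempty with h | ⟨y, hy, hyt⟩
    · simp [h, ENNReal.zero_rpow_of_pos ha]
    · have : t ∈ closure (f '' U k i) := subset_closure ⟨y, hy, hyt⟩
      rw [indicator_of_mem this]
      gcongr
      exact inter_subset_left

/-- If `P` is injective on `M` with Lipschitz inverse, then, for the Hausdorff measure of the
dimension of the target of `P`, all but countably many level sets in `M` are null. -/
theorem countable_hausdorffMeasure_level_ne_zero {Y V : Type*} [MetricSpace Y]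
    [MeasurableSpace Y] [BorelSpace Y] [NormedAddCommGroup V] [NormedSpace ℝ V]
    [FiniteDimensional ℝ V] {M : Set Y} {P : Y → V} {C : NNReal}
    (hP : ∀ p ∈ M, ∀ p' ∈ M, dist p p' ≤ C * dist (P p) (P p'))
    {φ : Y → ℝ} (hφ : Continuous φ) :
    {c : ℝ | μH[Module.finrank ℝ V] (M ∩ φ ⁻¹' {c}) ≠ 0}.Countable := by
  borelize V
  set μ : Measure Y := μH[Module.finrank ℝ V]
  let A : ℕ → Set Y := fun n => M ∩ P ⁻¹' closedBall 0 n
  have hA : ∀ n, μ (A n) < ⊤ := fun n => by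
    rcases isEmpty_or_nonempty Y with hY | hY
    · simp [Set.eq_empty_of_isEmpty]
    have hinj : InjOn P M := fun p hp p' hp' h =>
      dist_le_zero.1 (by simpa [h] using hP p hp p' hp')
    have hinv : ∀ p ∈ M, Function.invFunOn P M (P p) = p := fun p hp =>
      hinj.leftInvOn_invFunOn hp
    have hlip : LipschitzOnWith C (Function.invFunOn P M) (P '' A n) := by
      refine LipschitzOnWith.of_dist_le_mul ?_
      rintro _ ⟨p, hp, rfl⟩ _ ⟨p', hp', rfl⟩
      rw [hinv p hp.1, hinv p' hp'.1]
      exact hP p hp.1 p' hp'.1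
    have hsub : A n ⊆ Function.invFunOn P M '' (P '' A n) := fun p hp =>
      ⟨P p, ⟨p, hp, rfl⟩, hinv p hp.1⟩
    refine (measure_mono hsub).trans_lt
      ((hlip.hausdorffMeasure_image_le (Nat.cast_nonneg _)).trans_lt ?_)
    refine ENNReal.mul_lt_top (by simp) ?_
    refine (measure_mono (t := closedBall 0 (n : ℝ)) ?_).trans_lt
      (isCompact_closedBall _ _).measure_lt_top
    rintro _ ⟨p, hp, rfl⟩
    exact hp.2
  have hc : ∀ n, {c : ℝ | 0 < μ.restrict (A n) {p | φ p = c}}.Countable := fun n => by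
    have : IsFiniteMeasure (μ.restrict (A n)) := ⟨by simpa using hA n⟩
    exact Measure.countable_meas_level_set_pos hφ.measurable
  refine (countable_iUnion hc).mono fun c hcne => ?_
  by_contra hcon
  simp only [mem_iUnion, mem_ofPred_eq, not_exists, not_lt, nonpos_iff_eq_zero] at hcon
  refine hcne (measure_mono_null (t := ⋃ n, {p | φ p = c} ∩ A n) ?_ (measure_iUnion_null ?_))
  · rintro p ⟨hp, hpc⟩
    obtain ⟨n, hn⟩ := exists_nat_ge ‖P p‖
    exact mem_iUnion.2 ⟨n, hpc, hp, by simpa using hn⟩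
  · intro n
    rw [← hcon n, Measure.restrict_apply (measurableSet_eq_fun hφ.measurable measurable_const)]

/-- Let `M` have convex fibres over the first factor and be an image of a subset of `V` under a
Lipschitz map. Then the points with more than one preimage under `(x, n) ↦ (x, L n)` form
a null set. -/
theorem hausdorffMeasure_nonunique_fibre_eq_zero {V W : Type*}
    [NormedAddCommGroup V] [NormedSpace ℝ V] [FiniteDimensional ℝ V]
    [MeasurableSpace V] [BorelSpace V]
    [NormedAddCommGroup W] [NormedSpace ℝ W] [FiniteDimensional ℝ W]
    [MeasurableSpace W] [BorelSpace W]
    {M : Set (V × V)} {P : V × V → V} {C : NNReal}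
    (hP : ∀ p ∈ M, ∀ p' ∈ M, dist p p' ≤ C * dist (P p) (P p'))
    (hconv : ∀ x, Convex ℝ {n | (x, n) ∈ M}) (L : V →L[ℝ] W) :
    μH[Module.finrank ℝ V]
      {y : V × W | ∃ n m, (y.1, n) ∈ M ∧ (y.1, m) ∈ M ∧ n ≠ m ∧ L n = y.2 ∧ L m = y.2} = 0 := by
  have : SecondCountableTopology V := have := FiniteDimensional.proper ℝ V; inferInstance
  have : SecondCountableTopology W := have := FiniteDimensional.proper ℝ W; inferInstance
  let b := Module.finBasis ℝ V
  let φ : Fin (Module.finrank ℝ V) → V →L[ℝ] ℝ := fun i => (b.coord i).toContinuousLinearMap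
  let F : V × V →L[ℝ] V × W := (ContinuousLinearMap.id ℝ V).prodMap L
  have hlevel : ∀ i, ∃ Q : Set ℝ, Q.Countable ∧ Dense Q ∧
      ∀ c ∈ Q, μH[Module.finrank ℝ V] (M ∩ (fun p : V × V => φ i p.2) ⁻¹' {c}) = 0 := fun i => by
    have hc := countable_hausdorffMeasure_level_ne_zero hP
      (φ := fun p : V × V => φ i p.2) (by fun_prop)
    obtain ⟨Q, hQ, hQc, hQd⟩ := (hc.dense_compl ℝ).exists_countable_dense_subset
    exact ⟨Q, hQc, hQd, fun c hcQ => by simpa using hQ hcQ⟩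
  choose Q hQc hQd hQ using hlevel
  refine measure_mono_null
    (t := ⋃ i, ⋃ c ∈ Q i, F '' (M ∩ (fun p : V × V => φ i p.2) ⁻¹' {c})) ?_ ?_
  · rintro ⟨x, w⟩ ⟨n, m, hn, hm, hnm, hLn, hLm⟩
    simp only at hn hm hLn hLm
    obtain ⟨i, hi⟩ : ∃ i, φ i n ≠ φ i m := by
      by_contra! h
      exact hnm (b.ext_elem h)
    have key : ∃ c ∈ Q i, ∃ z ∈ segment ℝ n m, φ i z = c := by
      have himg : φ i '' segment ℝ n m = segment ℝ (φ i n) (φ i m) :=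
        image_segment ℝ (φ i : V →ₗ[ℝ] ℝ).toAffineMap n m
      rw [segment_eq_uIcc] at himg
      obtain ⟨c, hcQ, hc⟩ := (hQd i).exists_between
        (inf_lt_sup.2 hi)
      obtain ⟨z, hz, hzc⟩ := himg.symm.subset (Ioo_subset_Icc_self hc)
      exact ⟨c, hcQ, z, hz, hzc⟩
    obtain ⟨c, hcQ, z, hz, hzc⟩ := key
    have hLz : L z = w := by
      obtain ⟨α, β, -, -, hαβ, rfl⟩ := hz
      rw [map_add, map_smul, map_smul, hLn, hLm, ← add_smul, hαβ, one_smul]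
    simp only [mem_iUnion]
    exact ⟨i, c, hcQ, (x, z), ⟨(hconv x).segment_subset hn hm hz, hzc⟩, by simp [F, hLz]⟩
  · refine measure_iUnion_null fun i => (measure_biUnion_null_iff (hQc i)).2 fun c hcQ => ?_
    have h := F.lipschitz.hausdorffMeasure_image_le
      (Nat.cast_nonneg (α := ℝ) (Module.finrank ℝ V))
      (M ∩ (fun p : V × V => φ i p.2) ⁻¹' {c})
    rw [hQ i c hcQ, mul_zero] at h
    exact le_antisymm h zero_le

/-- If a set is `H^{a+1}`-null and star-shaped in the second factor, then its points with unit
second component form an `H^a`-null set. -/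
theorem hausdorffMeasure_norm_snd_eq_one_eq_zero {V W : Type*}
    [NormedAddCommGroup V] [NormedSpace ℝ V] [NormedAddCommGroup W] [NormedSpace ℝ W]
    [MeasurableSpace (V × W)] [BorelSpace (V × W)] {a : ℝ} (ha : 0 < a) {S : Set (V × W)}
    (hS : μH[a + 1] S = 0) (hstar : ∀ y ∈ S, ∀ t ∈ Ioo (0 : ℝ) 1, (y.1, t • y.2) ∈ S) :
    μH[a] {y ∈ S | ‖y.2‖ = 1} = 0 := by
  have hf : LipschitzWith 1 fun y : V × W => ‖y.2‖ := by
    simpa [Function.comp_def] using lipschitzWith_one_norm.comp (LipschitzWith.prod_snd (α := V))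
  obtain ⟨t, ht, ht0⟩ : ∃ t ∈ Ioo (0 : ℝ) 1, μH[a] (S ∩ (fun y => ‖y.2‖) ⁻¹' {t}) = 0 := by
    by_contra! h
    have hnull := measure_mono_null (t := {t | ¬ μH[a] (S ∩ (fun y => ‖y.2‖) ⁻¹' {t}) = 0})
      (fun t ht => h t ht) (ae_iff.1 (ae_hausdorffMeasure_slice_eq_zero ha hS hf))
    simp at hnull
  let G : V × W →L[ℝ] V × W :=
    (ContinuousLinearMap.id ℝ V).prodMap (t⁻¹ • ContinuousLinearMap.id ℝ W)
  refine measure_mono_null (t := G '' (S ∩ (fun y => ‖y.2‖) ⁻¹' {t})) ?_ ?_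
  · rintro y ⟨hy, hy1⟩
    refine ⟨(y.1, t • y.2), ⟨hstar y hy t ht, ?_⟩, ?_⟩
    · simp [norm_smul, hy1, abs_of_pos ht.1]
    · simp [G, smul_smul, inv_mul_cancel₀ ht.1.ne']
  · have h := G.lipschitz.hausdorffMeasure_image_le ha.le (S ∩ (fun y => ‖y.2‖) ⁻¹' {t})
    rw [ht0, mul_zero] at h
    exact le_antisymm h zero_le

/-- Tuples of points of the sets `X i` with vectors that are normal in the sense of a
quadratic inequality with constant `K`. -/
def quadraticNormalPairs {ι E : Type*} [NormedAddCommGroup E] [InnerProductSpace ℝ E]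
    (X : ι → Set E) (K : ℝ) : Set ((ι → E) × (ι → E)) :=
  {p | ∀ i, p.1 i ∈ X i ∧ ∀ y ∈ X i, inner ℝ (p.2 i) (y - p.1 i) ≤ K * ‖y - p.1 i‖ ^ 2}

section quadraticNormalPairs

variable {ι E : Type*} [NormedAddCommGroup E] [InnerProductSpace ℝ E]

theorem convex_quadraticNormalPairs (X : ι → Set E) (K : ℝ) (x : ι → E) :
    Convex ℝ {n | (x, n) ∈ quadraticNormalPairs X K} := by
  intro n hn m hm a b ha hb hab i
  refine ⟨(hn i).1, fun y hy => ?_⟩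
  have h1 := mul_le_mul_of_nonneg_left ((hn i).2 y hy) ha
  have h2 := mul_le_mul_of_nonneg_left ((hm i).2 y hy) hb
  simp only [Pi.add_apply, Pi.smul_apply, inner_add_left, real_inner_smul_left] at h1 h2 ⊢
  calc _ ≤ a * (K * ‖y - x i‖ ^ 2) + b * (K * ‖y - x i‖ ^ 2) := add_le_add h1 h2
    _ = _ := by rw [← add_mul, hab, one_mul]

theorem smul_mem_quadraticNormalPairs {X : ι → Set E} {K : ℝ} (hK : 0 ≤ K) {x n : ι → E}
    (h : (x, n) ∈ quadraticNormalPairs X K) {t : ℝ} (ht : t ∈ Ioo (0 : ℝ) 1) :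
    (x, t • n) ∈ quadraticNormalPairs X K := by
  intro i
  refine ⟨(h i).1, fun y hy => ?_⟩
  have h1 := mul_le_mul_of_nonneg_left ((h i).2 y hy) ht.1.le
  simp only [Pi.smul_apply, real_inner_smul_left] at h1 ⊢
  refine h1.trans (mul_le_of_le_one_left (by positivity) ht.2.le)

theorem norm_sub_le_of_quadratic_normal {x y n m : E} {K s : ℝ} (hs : 0 ≤ s)
    (hsK : 4 * s * K ≤ 1) (hn : inner ℝ n (y - x) ≤ K * ‖y - x‖ ^ 2)
    (hm : inner ℝ m (x - y) ≤ K * ‖x - y‖ ^ 2) :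
    ‖x - y‖ ≤ 2 * ‖(x + s • n) - (y + s • m)‖ := by
  have hcs := real_inner_le_norm ((x + s • n) - (y + s • m)) (x - y)
  have heq : inner ℝ ((x + s • n) - (y + s • m)) (x - y) =
      ‖x - y‖ ^ 2 - s * inner ℝ n (y - x) - s * inner ℝ m (x - y) := by
    rw [← real_inner_self_eq_norm_sq]
    simp only [inner_sub_left, inner_sub_right, inner_add_left, real_inner_smul_left]
    ring
  rw [norm_sub_rev y x] at hn
  have h1 := mul_le_mul_of_nonneg_left hn hs
  have h2 := mul_le_mul_of_nonneg_left hm hs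
  have h3 := mul_le_mul_of_nonneg_right hsK (sq_nonneg ‖x - y‖)
  by_contra! hlt
  nlinarith [norm_nonneg ((x + s • n) - (y + s • m)), norm_nonneg (x - y)]

theorem dist_le_of_mem_quadraticNormalPairs [Fintype ι] {X : ι → Set E} {K s : ℝ} (hs : 0 < s)
    (hsK : 4 * s * K ≤ 1) {p p' : (ι → E) × (ι → E)} (hp : p ∈ quadraticNormalPairs X K)
    (hp' : p' ∈ quadraticNormalPairs X K) :
    dist p p' ≤ max 2 (s⁻¹ * 3) * dist (p.1 + s • p.2) (p'.1 + s • p'.2) := by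
  have hx : ∀ i, ‖p.1 i - p'.1 i‖ ≤
      2 * ‖(p.1 i + s • p.2 i) - (p'.1 i + s • p'.2 i)‖ := fun i =>
    norm_sub_le_of_quadratic_normal hs.le hsK ((hp i).2 _ (hp' i).1) ((hp' i).2 _ (hp i).1)
  have hz : ∀ i, ‖(p.1 i + s • p.2 i) - (p'.1 i + s • p'.2 i)‖ ≤
      dist (p.1 + s • p.2) (p'.1 + s • p'.2) := fun i => by
    simpa [dist_eq_norm] using dist_le_pi_dist (p.1 + s • p.2) (p'.1 + s • p'.2) i
  have hn : ∀ i, ‖p.2 i - p'.2 i‖ ≤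
      s⁻¹ * 3 * ‖(p.1 i + s • p.2 i) - (p'.1 i + s • p'.2 i)‖ := fun i => by
    have heq : p.2 i - p'.2 i = s⁻¹ • (((p.1 i + s • p.2 i) - (p'.1 i + s • p'.2 i)) -
        (p.1 i - p'.1 i)) := by
      rw [eq_inv_smul_iff₀ hs.ne', smul_sub]
      abel
    rw [heq, norm_smul, Real.norm_of_nonneg (inv_nonneg.2 hs.le), mul_assoc]
    gcongr
    linarith [norm_sub_le ((p.1 i + s • p.2 i) - (p'.1 i + s • p'.2 i)) (p.1 i - p'.1 i), hx i]
  have hpos : 0 ≤ max 2 (s⁻¹ * 3) * dist (p.1 + s • p.2) (p'.1 + s • p'.2) := by positivity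
  refine max_le ((dist_pi_le_iff hpos).2 fun i => ?_) ((dist_pi_le_iff hpos).2 fun i => ?_)
  · rw [dist_eq_norm]
    exact (hx i).trans (mul_le_mul (le_max_left _ _) (hz i) (norm_nonneg _) (by positivity))
  · rw [dist_eq_norm]
    exact (hn i).trans (mul_le_mul (le_max_right _ _) (hz i) (norm_nonneg _) (by positivity))

/-- For tuples of normals, the points with more than one preimage under a linear map in the
normal variable, restricted to unit values, are null in codimension one. -/
theorem hausdorffMeasure_nonunique_normals_eq_zero [Fintype ι] [FiniteDimensional ℝ E]
    [MeasurableSpace E] [BorelSpace E] (X : ι → Set E) {K : ℝ} (hK : 0 ≤ K)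
    (L : (ι → E) →L[ℝ] E) {a : ℝ} (ha : 0 < a) (hdim : Module.finrank ℝ (ι → E) = a + 1) :
    μH[a] {y : (ι → E) × E | (∃ n m, (y.1, n) ∈ quadraticNormalPairs X K ∧
      (y.1, m) ∈ quadraticNormalPairs X K ∧ n ≠ m ∧ L n = y.2 ∧ L m = y.2) ∧ ‖y.2‖ = 1} = 0 := by
  have : SecondCountableTopology E := have := FiniteDimensional.proper ℝ E; inferInstance
  have hs : (0 : ℝ) < (4 * (K + 1))⁻¹ := by positivity
  have hsK : 4 * (4 * (K + 1))⁻¹ * K ≤ 1 := by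
    rw [mul_inv, ← mul_assoc, mul_inv_cancel₀ (by norm_num), one_mul,
      inv_mul_le_one₀ (by positivity)]
    linarith
  have h := hausdorffMeasure_nonunique_fibre_eq_zero (M := quadraticNormalPairs X K)
    (P := fun p => p.1 + (4 * (K + 1))⁻¹ • p.2)
    (C := ⟨max 2 ((4 * (K + 1))⁻¹⁻¹ * 3), by positivity⟩)
    (fun p hp p' hp' => dist_le_of_mem_quadraticNormalPairs hs hsK hp hp')
    (convex_quadraticNormalPairs X K) L
  rw [hdim] at h
  refine hausdorffMeasure_norm_snd_eq_one_eq_zero ha h ?_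
  rintro y ⟨n, m, hn, hm, hnm, hLn, hLm⟩ t ht
  exact ⟨t • n, t • m, smul_mem_quadraticNormalPairs hK hn ht,
    smul_mem_quadraticNormalPairs hK hm ht, fun h => hnm (smul_right_injective _ ht.1.ne' h),
    by simp [hLn], by simp [hLm]⟩

end quadraticNormalPairs

theorem inner_le_of_mem_unitNormalBundle {d : ℕ} {X : Set (EuclideanSpace ℝ (Fin d))} {r : ℝ}
    (hr : 0 < r) {x u y : EuclideanSpace ℝ (Fin d)} (h : (x, u) ∈ unitNormalBundle X r)
    (hy : y ∈ X) : inner ℝ u (y - x) ≤ r⁻¹ * ‖y - x‖ ^ 2 := by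
  obtain ⟨-, hu, ht⟩ := h
  simp only at hu ht
  have h2 : r / 2 ∈ Ioo 0 r := ⟨by positivity, by linarith⟩
  have hle : r / 2 ≤ ‖(y - x) - (r / 2) • u‖ := by
    have := infDist_le_dist_of_mem (x := x + (r / 2) • u) hy
    rw [ht _ h2, dist_comm, dist_eq_norm] at this
    rwa [sub_sub]
  have hsq := pow_le_pow_left₀ h2.1.le hle 2
  rw [norm_sub_sq_real, norm_smul, hu, real_inner_smul_right, real_inner_comm u,
    Real.norm_of_nonneg h2.1.le] at hsq
  rw [inv_mul_eq_div, le_div_iff₀ hr]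
  nlinarith

theorem exists_smul_mem_quadraticNormalPairs {d q : ℕ}
    {X : Fin q → Set (EuclideanSpace ℝ (Fin d))} {r : Fin q → ℝ} (hr : ∀ i, 0 < r i)
    {x u : Fin q → EuclideanSpace ℝ (Fin d)} (h : ∀ i, (x i, u i) ∈ unitNormalBundle (X i) (r i))
    {c : Fin q → ℝ} (hc : ∀ i, 0 ≤ c i) :
    ∃ K : ℕ, ∀ K' : ℕ, K ≤ K' → (x, fun i => c i • u i) ∈ quadraticNormalPairs X K' := by
  obtain ⟨K, hK⟩ := exists_nat_ge (∑ i, c i * (r i)⁻¹)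
  refine ⟨K, fun K' hKK' i => ⟨(h i).1, fun y hy => ?_⟩⟩
  have h1 := mul_le_mul_of_nonneg_left
    (inner_le_of_mem_unitNormalBundle (hr i) (h i) hy) (hc i)
  have h2 : c i * (r i)⁻¹ ≤ K' :=
    (Finset.single_le_sum (f := fun i => c i * (r i)⁻¹)
      (fun j _ => mul_nonneg (hc j) (inv_nonneg.2 (hr j).le)) (Finset.mem_univ i)).trans
      (hK.trans (by exact_mod_cast hKK'))
  simp only [real_inner_smul_left]
  refine h1.trans ?_
  rw [← mul_assoc]
  gcongr

/-- Two different representations of a unit vector as normalized combinations of unit normals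
give two different tuples of normals with the same partial sum. -/
theorem exists_normals_ne_of_representations_ne {d q : ℕ}
    {X : Fin q → Set (EuclideanSpace ℝ (Fin d))} {r : Fin q → ℝ} (hr : ∀ i, 0 < r i)
    {x u v : Fin q → EuclideanSpace ℝ (Fin d)} {t s : EuclideanSpace ℝ (Fin q)}
    {w : EuclideanSpace ℝ (Fin d)}
    (hu : ∀ i, (x i, u i) ∈ unitNormalBundle (X i) (r i))
    (hv : ∀ i, (x i, v i) ∈ unitNormalBundle (X i) (r i))
    (ht : ‖t‖ = 1) (ht0 : ∀ i, 0 ≤ t i) (hs : ‖s‖ = 1) (hs0 : ∀ i, 0 ≤ s i)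
    {a b : ℝ} (ha : 0 < a) (hb : 0 < b)
    (htw : a • ∑ i, t i • u i = w) (hsw : b • ∑ i, s i • v i = w)
    (hne : ¬ (u = v ∧ t = s)) :
    ∃ (K : ℕ) (J : Finset (Fin q)) (n m : Fin q → EuclideanSpace ℝ (Fin d)),
      (x, n) ∈ quadraticNormalPairs X K ∧ (x, m) ∈ quadraticNormalPairs X K ∧ n ≠ m ∧
      ∑ i ∈ J, n i = w ∧ ∑ i ∈ J, m i = w := by
  have hdegenerate : ∀ {u : Fin q → EuclideanSpace ℝ (Fin d)} {t : EuclideanSpace ℝ (Fin q)}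
      {a : ℝ}, (∀ i, (x i, u i) ∈ unitNormalBundle (X i) (r i)) → (∀ i, 0 ≤ t i) → 0 < a →
      a • ∑ i, t i • u i = w → (∃ i, t i = 0) →
      ∃ (K : ℕ) (J : Finset (Fin q)) (n m : Fin q → EuclideanSpace ℝ (Fin d)),
      (x, n) ∈ quadraticNormalPairs X K ∧ (x, m) ∈ quadraticNormalPairs X K ∧ n ≠ m ∧
      ∑ i ∈ J, n i = w ∧ ∑ i ∈ J, m i = w := by
    rintro u t a hu ht0 ha htw ⟨j, hj⟩
    obtain ⟨K₁, hK₁⟩ := exists_smul_mem_quadraticNormalPairs hr hu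
      (c := fun i => a * t i) (fun i => mul_nonneg ha.le (ht0 i))
    obtain ⟨K₂, hK₂⟩ := exists_smul_mem_quadraticNormalPairs hr hu
      (c := fun i => if i = j then 1 else a * t i)
      (fun i => by have := mul_nonneg ha.le (ht0 i); split_ifs <;> simp [this])
    have hsum : ∑ i ∈ Finset.univ.erase j, (a * t i) • u i = w := by
      rw [← htw, Finset.smul_sum, Finset.sum_erase _ (by simp [hj])]
      simp only [smul_smul]
    refine ⟨max K₁ K₂, Finset.univ.erase j, _, _, hK₁ _ (le_max_left _ _),
      hK₂ _ (le_max_right _ _), fun h => ?_, hsum, ?_⟩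
    · have h1 := congrFun h j
      have h2 : ‖u j‖ = 1 := (hu j).2.1
      simp only [hj, mul_zero, zero_smul, if_true, one_smul] at h1
      simp [← h1] at h2
    · rw [← hsum]
      exact Finset.sum_congr rfl fun i hi => by rw [if_neg (Finset.ne_of_mem_erase hi)]
  by_cases hjt : ∃ j, t j = 0
  · exact hdegenerate hu ht0 ha htw hjt
  by_cases hjs : ∃ j, s j = 0
  · exact hdegenerate hv hs0 hb hsw hjs
  obtain ⟨K₁, hK₁⟩ := exists_smul_mem_quadraticNormalPairs hr hu
    (c := fun i => a * t i) (fun i => mul_nonneg ha.le (ht0 i))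
  obtain ⟨K₂, hK₂⟩ := exists_smul_mem_quadraticNormalPairs hr hv
    (c := fun i => b * s i) (fun i => mul_nonneg hb.le (hs0 i))
  refine ⟨max K₁ K₂, Finset.univ, _, _, hK₁ _ (le_max_left _ _),
    hK₂ _ (le_max_right _ _), fun h => hne ?_, ?_, ?_⟩
  · have hcoef : a • t = b • s := by
      ext i
      have h1 := congrArg norm (congrFun h i)
      have hui : ‖u i‖ = 1 := (hu i).2.1
      have hvi : ‖v i‖ = 1 := (hv i).2.1
      simpa [norm_smul, hui, hvi, abs_of_pos ha, abs_of_pos hb, abs_of_nonneg (ht0 i),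
        abs_of_nonneg (hs0 i)] using h1
    have hab : a = b := by
      simpa [norm_smul, ht, hs, abs_of_pos ha, abs_of_pos hb] using congrArg norm hcoef
    have hts : t = s := smul_right_injective _ ha.ne' (hcoef.trans (by rw [hab]))
    refine ⟨funext fun i => ?_, hts⟩
    have h1 := congrFun h i
    simp only [← hab, ← hts] at h1
    exact smul_right_injective _ (mul_ne_zero ha.ne' fun h0 => hjt ⟨i, h0⟩) h1
  · rw [← htw, Finset.smul_sum]
    simp only [smul_smul]
  · rw [← hsw, Finset.smul_sum]
    simp only [smul_smul]

/-- Nonzero nonnegative combinations of vectors whose cone omits zero do not vanish. -/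
theorem sum_smul_ne_zero_of_zero_notMem_coneOf {d q : ℕ} {u : Fin q → EuclideanSpace ℝ (Fin d)}
    (h : 0 ∉ coneOf u) {t : EuclideanSpace ℝ (Fin q)} (ht : ‖t‖ = 1) (ht0 : ∀ i, 0 ≤ t i) :
    ∑ i, t i • u i ≠ 0 := by
  refine fun h0 => h ⟨t, ht0, ?_, h0.symm⟩
  have := EuclideanSpace.real_norm_sq_eq t
  rw [← this, ht]
  norm_num

/-- For sets `X_1, …, X_q ⊆ ℝ^d` of positive reach, for `H^{qd-1}`-almost all points of the
image of the map `T : NK × S^{q-1}_+ → ℝ^{qd} × S^{d-1}`,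
`T(x_1,u_1,…,x_q,u_q,t) = (x_1,…,x_q, (∑ t_i u_i)/‖∑ t_i u_i‖)`, the preimage under `T`
is a single point. -/
theorem almost_everywhere_unique_preimage
    (d q : ℕ) (hd : 2 ≤ d) (hq : 2 ≤ q)
    (X : Fin q → Set (EuclideanSpace ℝ (Fin d))) (r : Fin q → ℝ) (hr : ∀ i, 0 < r i)
    (hXne : ∀ i, (X i).Nonempty) (hXcl : ∀ i, IsClosed (X i))
    (hX : ∀ i, HasReachGE (X i) (r i)) :
    let E := EuclideanSpace ℝ (Fin d)
    -- the set NK = (nor X_1 × ⋯ × nor X_q) ∩ R^c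
    let NK : Set (Fin q → E × E) :=
      {p | (∀ i, p i ∈ unitNormalBundle (X i) (r i)) ∧
        (0 : E) ∉ coneOf (fun i => (p i).2)}
    -- S^{q-1}_+
    let Splus : Set (EuclideanSpace ℝ (Fin q)) := {t | ‖t‖ = 1 ∧ ∀ i, 0 ≤ t i}
    -- the domain NK × S^{q-1}_+ of T
    let D : Set ((Fin q → E × E) × EuclideanSpace ℝ (Fin q)) := NK ×ˢ Splus
    -- the map T
    let T : (Fin q → E × E) × EuclideanSpace ℝ (Fin q) → (Fin q → E) × E :=
      fun p => (fun i => (p.1 i).1,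
        ‖∑ i, p.2 i • (p.1 i).2‖⁻¹ • ∑ i, p.2 i • (p.1 i).2)
    -- the set of image points with more than one preimage is H^{qd-1}-null
    μH[(q * d - 1 : ℝ)]
      {y ∈ T '' D | ¬ Set.Subsingleton (D ∩ T ⁻¹' {y})} = 0 := by

  intro E NK Splus D T
  let Bad : ℕ → Finset (Fin q) → Set ((Fin q → E) × E) := fun K J =>
    {y | (∃ n m, (y.1, n) ∈ quadraticNormalPairs X K ∧ (y.1, m) ∈ quadraticNormalPairs X K ∧
      n ≠ m ∧ ∑ i ∈ J, n i = y.2 ∧ ∑ i ∈ J, m i = y.2) ∧ ‖y.2‖ = 1}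
  have hBad : ∀ K J, μH[(q * d - 1 : ℝ)] (Bad K J) = 0 := fun K J => by
    have hdim : (Module.finrank ℝ (Fin q → E) : ℝ) = (q * d - 1 : ℝ) + 1 := by
      simp [E, Module.finrank_pi_fintype]
    have hpos : (0 : ℝ) < q * d - 1 := by
      have hq2 : (2 : ℝ) ≤ q := by exact_mod_cast hq
      have hd2 : (2 : ℝ) ≤ d := by exact_mod_cast hd
      nlinarith
    simpa [Bad] using hausdorffMeasure_nonunique_normals_eq_zero X (Nat.cast_nonneg K)
      (∑ i ∈ J, ContinuousLinearMap.proj i : (Fin q → E) →L[ℝ] E) hpos hdim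
  refine measure_mono_null (t := ⋃ K, ⋃ J, Bad K J) ?_
    (measure_iUnion_null fun K => measure_iUnion_null fun J => hBad K J)
  rintro y ⟨-, hy⟩
  obtain ⟨p, ⟨⟨⟨hpN, hpc⟩, hpt, hpt0⟩, hpy⟩, p', ⟨⟨⟨hpN', hpc'⟩, hpt', hpt0'⟩, hpy'⟩, hne⟩ :=
    Set.not_subsingleton_iff.1 hy
  have hS := sum_smul_ne_zero_of_zero_notMem_coneOf hpc hpt hpt0
  have hS' := sum_smul_ne_zero_of_zero_notMem_coneOf hpc' hpt' hpt0'
  have hx : ∀ i, (p.1 i).1 = y.1 i := fun i => congrFun (congrArg Prod.fst hpy) i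
  have hx' : ∀ i, (p'.1 i).1 = y.1 i := fun i => congrFun (congrArg Prod.fst hpy') i
  have hw : ‖∑ i, p.2 i • (p.1 i).2‖⁻¹ • ∑ i, p.2 i • (p.1 i).2 = y.2 := congrArg Prod.snd hpy
  have hw' : ‖∑ i, p'.2 i • (p'.1 i).2‖⁻¹ • ∑ i, p'.2 i • (p'.1 i).2 = y.2 :=
    congrArg Prod.snd hpy'
  obtain ⟨K, J, n, m, hn, hm, hnm, hJn, hJm⟩ := exists_normals_ne_of_representations_ne hr
    (x := y.1) (u := fun i => (p.1 i).2) (v := fun i => (p'.1 i).2)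
    (fun i => by rw [← hx i]; exact hpN i) (fun i => by rw [← hx' i]; exact hpN' i)
    hpt hpt0 hpt' hpt0'
    (inv_pos.2 (norm_pos_iff.2 hS)) (inv_pos.2 (norm_pos_iff.2 hS')) hw hw'
    (fun h => hne (Prod.ext (funext fun i =>
      Prod.ext ((hx i).trans (hx' i).symm) (congrFun h.1 i)) h.2))
  refine mem_iUnion.2 ⟨K, mem_iUnion.2 ⟨J, ⟨n, m, hn, hm, hnm, hJn, hJm⟩, ?_⟩⟩
  rw [← hw, norm_smul, norm_inv, norm_norm, inv_mul_cancel₀ (norm_ne_zero_iff.2 hS)]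
end
end

section
/- Let d ≥ 2, 2 ≤ q ≤ d, and let u_1,…,u_q ∈ S^{d-1} ⊆ ℝ^d be linearly independent unit vectors. Let Δ := conv{u_1,…,u_q} be their convex hull and ρ := dist(0, Δ) (which is positive, since linear independence implies 0 ∉ Δ). Then for every real α ≥ 0, ∫_Δ ‖z‖^{−α} dH^{q-1}(z) ≤ ∫_{B^{q-1}(0,2)} (ρ² + ‖x‖²)^{−α/2} dH^{q-1}(x), where B^{q-1}(0,2) is the closed ball of radius 2 centered at the origin in ℝ^{q-1}. -/
open MeasureTheory Metric Set

noncomputable section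

/-- The nearest point `p` of a convex set to the origin satisfies
`‖p‖² + ‖z - p‖² ≤ ‖z‖²` for every `z` in the set. -/
theorem Convex.norm_sq_add_norm_sub_sq_le {E : Type*} [NormedAddCommGroup E]
    [InnerProductSpace ℝ E] {K : Set E} (hK : Convex ℝ K) {p : E} (hp : p ∈ K)
    (hmin : infDist 0 K = ‖p‖) {z : E} (hz : z ∈ K) :
    ‖p‖ ^ 2 + ‖z - p‖ ^ 2 ≤ ‖z‖ ^ 2 := by
  have h1 : ‖(0 : E) - p‖ = ⨅ w : K, ‖(0 : E) - w‖ := by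
    rw [zero_sub, norm_neg, ← hmin, infDist_eq_iInf]
    simp only [dist_eq_norm]
  have h2 := (norm_eq_iInf_iff_real_inner_le_zero hK hp).1 h1 z hz
  rw [zero_sub, inner_neg_left] at h2
  have h3 := norm_add_sq_real p (z - p)
  rw [add_sub_cancel] at h3
  linarith

/-- If `z - p` lies in an `n`-dimensional subspace and has norm at most `r` for all `z` in `K`,
then `K` is contained in an isometric image of the ball of radius `r` of `ℝⁿ` centred at `0`,
with the centre sent to `p`. -/
theorem exists_isometry_subset_image_closedBall {E : Type*} [NormedAddCommGroup E]
    [InnerProductSpace ℝ E] {n : ℕ} (V : Submodule ℝ E) [FiniteDimensional ℝ V]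
    (hV : Module.finrank ℝ V = n) {K : Set E} {p : E} (r : ℝ)
    (hK : ∀ z ∈ K, z - p ∈ V ∧ ‖z - p‖ ≤ r) :
    ∃ g : EuclideanSpace ℝ (Fin n) → E, Isometry g ∧ (∀ x, ‖g x - p‖ = ‖x‖) ∧
      K ⊆ g '' closedBall 0 r := by
  let e := (stdOrthonormalBasis ℝ V).reindex (finCongr hV)
  let L := e.repr.symm
  refine ⟨fun x => p + (L x : E), ?_, fun x => ?_, fun z hz => ?_⟩
  · exact (isometry_add_left p).comp (isometry_subtype_coe.comp L.isometry)
  · rw [add_sub_cancel_left]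
    exact L.norm_map x
  · obtain ⟨h1, h2⟩ := hK z hz
    refine ⟨L.symm ⟨z - p, h1⟩, ?_, by simp⟩
    rw [mem_closedBall_zero_iff, LinearIsometryEquiv.norm_map]
    exact h2

theorem LinearIndependent.affineIndependent_of_module {ι V : Type*} [AddCommGroup V] [Module ℝ V]
    {u : ι → V} (hu : LinearIndependent ℝ u) : AffineIndependent ℝ u :=
  affineIndependent_iff.2 fun s w _ h => linearIndependent_iff'.1 hu s w h

/-- If `‖p‖² + t² ≤ ‖z‖²` with `t = ‖z - p‖`, then `‖z‖^{-α} ≤ (‖p‖² + t²)^{-α/2}`. -/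
theorem rpow_neg_norm_le {E : Type*} [NormedAddCommGroup E] {p z : E} {α : ℝ} (hα : 0 ≤ α)
    (h : ‖p‖ ^ 2 + ‖z - p‖ ^ 2 ≤ ‖z‖ ^ 2) :
    ‖z‖ ^ (-α) ≤ (‖p‖ ^ 2 + ‖z - p‖ ^ 2) ^ (-α / 2) := by
  have h1 : ‖z‖ ^ (-α) = (‖z‖ ^ 2) ^ (-α / 2) := by
    rw [← Real.rpow_natCast, ← Real.rpow_mul (norm_nonneg z)]
    congr 1
    push_cast
    ring
  rw [h1]
  rcases (by positivity : (0 : ℝ) ≤ ‖p‖ ^ 2 + ‖z - p‖ ^ 2).eq_or_lt with h0 | h0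
  · have hp : p = 0 := by
      have : ‖p‖ ^ 2 = 0 := by nlinarith [sq_nonneg ‖p‖, sq_nonneg ‖z - p‖]
      simpa using this
    simp [hp]
  · exact Real.rpow_le_rpow_of_nonpos h0 h (by linarith)

/-- Let `u_1,…,u_q ∈ S^{d-1} ⊆ ℝ^d` be linearly independent unit vectors,
`Δ = conv{u_1,…,u_q}` and `ρ = dist(0, Δ)`. Then for every real `α ≥ 0`,
`∫_Δ ‖z‖^{-α} dH^{q-1}(z) ≤ ∫_{B^{q-1}(0,2)} (ρ² + ‖x‖²)^{-α/2} dH^{q-1}(x)`. -/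
theorem integral_convexHull_norm_le (d q : ℕ) (hd : 2 ≤ d) (hq : 2 ≤ q) (hqd : q ≤ d)
    (u : Fin q → EuclideanSpace ℝ (Fin d)) (hu : ∀ i, ‖u i‖ = 1)
    (hli : LinearIndependent ℝ u) (α : ℝ) (hα : 0 ≤ α) :
    (∫⁻ z in convexHull ℝ (Set.range u), ENNReal.ofReal (‖z‖ ^ (-α))
        ∂ μH[((q : ℝ) - 1)])
      ≤ ∫⁻ x in Metric.closedBall (0 : EuclideanSpace ℝ (Fin (q - 1))) 2,
          ENNReal.ofReal
            ((Metric.infDist (0 : EuclideanSpace ℝ (Fin d))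
                  (convexHull ℝ (Set.range u)) ^ 2 + ‖x‖ ^ 2) ^ (-α / 2))
          ∂ μH[((q : ℝ) - 1)] := by
  set K := convexHull ℝ (Set.range u) with hK_def
  have hKcomp : IsCompact K := (Set.finite_range u).isCompact_convexHull ℝ
  have hKconv : Convex ℝ K := convex_convexHull ℝ _
  have hKne : K.Nonempty := ⟨u ⟨0, by omega⟩, subset_convexHull ℝ _ (mem_range_self _)⟩
  obtain ⟨p, hp, hmin⟩ := hKcomp.exists_infDist_eq_dist hKne 0
  rw [dist_zero_left] at hmin
  have hKball : ∀ z ∈ K, ‖z‖ ≤ 1 := fun z hz => by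
    have hsub : K ⊆ closedBall 0 1 :=
      convexHull_min (by rintro _ ⟨i, rfl⟩; simp [hu i]) (convex_closedBall _ _)
    simpa using hsub hz
  have hfin : Module.finrank ℝ (vectorSpan ℝ (Set.range u)) = q - 1 :=
    hli.affineIndependent_of_module.finrank_vectorSpan (by rw [Fintype.card_fin]; omega)
  obtain ⟨g, hg, hgp, hgK⟩ := exists_isometry_subset_image_closedBall
    (vectorSpan ℝ (Set.range u)) hfin (K := K) (p := p) 2 fun z hz => by
      refine ⟨?_, (norm_sub_le z p).trans (by linarith [hKball z hz, hKball p hp])⟩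
      rw [← direction_affineSpan]
      exact AffineSubspace.vsub_mem_direction (convexHull_subset_affineSpan _ hz)
        (convexHull_subset_affineSpan _ hp)
  have hq0 : (0 : ℝ) ≤ (q : ℝ) - 1 := by
    have : (2 : ℝ) ≤ q := by exact_mod_cast hq
    linarith
  have hemb : MeasurableEmbedding g := hg.isClosedEmbedding.measurableEmbedding
  let F : EuclideanSpace ℝ (Fin d) → ENNReal :=
    fun z => ENNReal.ofReal ((‖p‖ ^ 2 + ‖z - p‖ ^ 2) ^ (-α / 2))
  rw [hmin]
  calc _ ≤ ∫⁻ z in K, F z ∂μH[((q : ℝ) - 1)] :=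
        setLIntegral_mono' hKcomp.isClosed.measurableSet fun z hz =>
          ENNReal.ofReal_le_ofReal (rpow_neg_norm_le hα
            (hKconv.norm_sq_add_norm_sub_sq_le hp hmin hz))
    _ ≤ ∫⁻ z in g '' closedBall 0 2, F z ∂μH[((q : ℝ) - 1)] := lintegral_mono_set hgK
    _ = ∫⁻ z in g '' closedBall 0 2, F z ∂(Measure.map g μH[((q : ℝ) - 1)]) := by
        rw [hg.map_hausdorffMeasure (Or.inl hq0),
          Measure.restrict_restrict_of_subset (image_subset_range _ _)]
    _ = ∫⁻ x in closedBall 0 2, F (g x) ∂μH[((q : ℝ) - 1)] := by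
        rw [hemb.restrict_map, hemb.lintegral_map, hemb.injective.preimage_image]
    _ = _ := by simp only [F, hgp]
end
end
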